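/- Let 0 < α < ω₁ and let E be a subset of a topological space X. Then the following conditions are equivalent: (i) E is K_α-embedded in X, i.e. every function f ∈ K_α(E) extends to a function g ∈ K_α(X); (ii) E is α-embedded in X and for every set A of the α'th functionally multiplicative class in X with E ∩ A = ∅, the sets E and A are α-separated. -/

import Mathlib

open Set

universe u v

/-- `A` is functionally open in `X`: `A = f⁻¹((0,1])` for some continuous `f : X → [0,1]`. -/
def FunctionallyOpen (X : Type u) [TopologicalSpace X] (A : Set X) : Prop :=
  ∃ f : X → ℝ, Continuous f ∧ (∀ x, f x ∈ Set.Icc (0:ℝ) 1) ∧ A = f ⁻¹' (Set.Ioc 0 1)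

/-- `A` is functionally closed in `X`: `A = f⁻¹(0)` for some continuous `f : X → [0,1]`. -/
def FunctionallyClosed (X : Type u) [TopologicalSpace X] (A : Set X) : Prop :=
  ∃ f : X → ℝ, Continuous f ∧ (∀ x, f x ∈ Set.Icc (0:ℝ) 1) ∧ A = f ⁻¹' {0}

mutual
/-- The `α`'th functionally additive class in `X`. -/
inductive FunAdd (X : Type u) [TopologicalSpace X] : Ordinal.{0} → Set X → Prop where
  | base (A : Set X) : FunctionallyOpen X A → FunAdd X 0 A
  | union (α : Ordinal.{0}) (hα : α ≠ 0) (β : ℕ → Ordinal.{0}) (hβ : ∀ n, β n < α)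
      (s : ℕ → Set X) (hs : ∀ n, FunMul X (β n) (s n)) : FunAdd X α (⋃ n, s n)

/-- The `α`'th functionally multiplicative class in `X`. -/
inductive FunMul (X : Type u) [TopologicalSpace X] : Ordinal.{0} → Set X → Prop where
  | base (A : Set X) : FunctionallyClosed X A → FunMul X 0 A
  | inter (α : Ordinal.{0}) (hα : α ≠ 0) (β : ℕ → Ordinal.{0}) (hβ : ∀ n, β n < α)
      (s : ℕ → Set X) (hs : ∀ n, FunAdd X (β n) (s n)) : FunMul X α (⋂ n, s n)
end

mutual
/-- The `α`'th (ordinary) additive Borel class in `X`. -/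
inductive BorelAdd (X : Type u) [TopologicalSpace X] : Ordinal.{0} → Set X → Prop where
  | base (A : Set X) : IsOpen A → BorelAdd X 0 A
  | union (α : Ordinal.{0}) (hα : α ≠ 0) (β : ℕ → Ordinal.{0}) (hβ : ∀ n, β n < α)
      (s : ℕ → Set X) (hs : ∀ n, BorelMul X (β n) (s n)) : BorelAdd X α (⋃ n, s n)

/-- The `α`'th (ordinary) multiplicative Borel class in `X`. -/
inductive BorelMul (X : Type u) [TopologicalSpace X] : Ordinal.{0} → Set X → Prop where
  | base (A : Set X) : IsClosed A → BorelMul X 0 A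
  | inter (α : Ordinal.{0}) (hα : α ≠ 0) (β : ℕ → Ordinal.{0}) (hβ : ∀ n, β n < α)
      (s : ℕ → Set X) (hs : ∀ n, BorelAdd X (β n) (s n)) : BorelMul X α (⋂ n, s n)
end

/-- A set is functionally ambiguous of class `α` if it belongs to both the `α`'th functionally
additive and the `α`'th functionally multiplicative class. -/
def FunAmbiguous (X : Type u) [TopologicalSpace X] (α : Ordinal.{0}) (A : Set X) : Prop :=
  FunAdd X α A ∧ FunMul X α A

/-- `f ∈ K_α(X,Y)`: for `α = 0` continuity, for `α > 0` preimages of open sets belong to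
the `α`'th functionally additive class. -/
def KClass {X : Type u} {Y : Type v} [TopologicalSpace X] [TopologicalSpace Y]
    (α : Ordinal.{0}) (f : X → Y) : Prop :=
  (α = 0 → Continuous f) ∧ (α ≠ 0 → ∀ V : Set Y, IsOpen V → FunAdd X α (f ⁻¹' V))

/-- `A` and `B` are `α`-separated in `X`. -/
def AlphaSeparated {X : Type u} [TopologicalSpace X] (α : Ordinal.{0}) (A B : Set X) : Prop :=
  ∃ f : X → ℝ, KClass α f ∧ A ⊆ f ⁻¹' {0} ∧ B ⊆ f ⁻¹' {1}

/-- `X` is an `α`-separated space: any two disjoint sets of the `α`'th (ordinary)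
multiplicative class are `α`-separated. -/
def AlphaSeparatedSpace (X : Type u) [TopologicalSpace X] (α : Ordinal.{0}) : Prop :=
  ∀ A B : Set X, BorelMul X α A → BorelMul X α B → Disjoint A B → AlphaSeparated α A B

/-- `E` is `α`-embedded in `X`. -/
def AlphaEmbedded {X : Type u} [TopologicalSpace X] (α : Ordinal.{0}) (E : Set X) : Prop :=
  (∀ A : Set ↥E, FunAdd ↥E α A → ∃ B : Set X, FunAdd X α B ∧ Subtype.val '' A = B ∩ E) ∧
  (∀ A : Set ↥E, FunMul ↥E α A → ∃ B : Set X, FunMul X α B ∧ Subtype.val '' A = B ∩ E)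

/-- `E` is ambiguously `α`-embedded in `X`. -/
def AmbiguouslyEmbedded {X : Type u} [TopologicalSpace X] (α : Ordinal.{0}) (E : Set X) : Prop :=
  ∀ A : Set ↥E, FunAmbiguous ↥E α A →
    ∃ B : Set X, FunAmbiguous X α B ∧ Subtype.val '' A = B ∩ E

/-- The first uncountable ordinal. -/
noncomputable def omega1 : Ordinal.{0} := (Cardinal.aleph 1).ord

/-- `A` is an `F_σ`-set: a countable union of closed sets. -/
def IsFSigma {X : Type u} [TopologicalSpace X] (A : Set X) : Prop :=
  ∃ F : ℕ → Set X, (∀ n, IsClosed (F n)) ∧ A = ⋃ n, F n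

/-- A space has a countable π-base. -/
def CountablePiBase (Z : Type v) [TopologicalSpace Z] : Prop :=
  ∃ 𝒰 : Set (Set Z), 𝒰.Countable ∧ (∀ U ∈ 𝒰, IsOpen U ∧ U.Nonempty) ∧
    ∀ V : Set Z, IsOpen V → V.Nonempty → ∃ U ∈ 𝒰, U ⊆ V


section helpers
variable {X : Type u} [TopologicalSpace X]

theorem fopen_compl {A : Set X} : FunctionallyOpen X A ↔ FunctionallyClosed X Aᶜ := by
  constructor
  · rintro ⟨f, hf, h, rfl⟩
    refine ⟨f, hf, h, ?_⟩
    ext x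
    have := h x
    simp only [mem_compl_iff, mem_preimage, mem_Ioc, mem_singleton_iff, mem_Icc] at *
    constructor
    · intro h1
      by_contra h2
      exact h1 ⟨lt_of_le_of_ne this.1 (Ne.symm h2), this.2⟩
    · intro h1 h2
      linarith [h2.1]
  · rintro ⟨f, hf, h, hA⟩
    refine ⟨f, hf, h, ?_⟩
    rw [← compl_compl A, hA]
    ext x
    have := h x
    simp only [mem_compl_iff, mem_preimage, mem_Ioc, mem_singleton_iff, mem_Icc] at *
    constructor
    · intro h1
      exact ⟨lt_of_le_of_ne this.1 (Ne.symm h1), this.2⟩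
    · intro h1 h2
      linarith [h1.1]

mutual
theorem add_compl : ∀ {α : Ordinal.{0}} {A : Set X}, FunAdd X α A → FunMul X α Aᶜ
  | _, _, .base A h => .base _ (fopen_compl.1 h)
  | _, _, .union α hα β hβ s hs => by
      rw [compl_iUnion]
      exact .inter α hα β hβ _ (fun n => mul_compl (hs n))
theorem mul_compl : ∀ {α : Ordinal.{0}} {A : Set X}, FunMul X α A → FunAdd X α Aᶜ
  | _, _, .base A h => .base _ (fopen_compl.2 (by rwa [compl_compl]))
  | _, _, .inter α hα β hβ s hs => by
      rw [compl_iInter]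
      exact .union α hα β hβ _ (fun n => add_compl (hs n))
end

mutual
theorem add_restr (E : Set X) : ∀ {α : Ordinal.{0}} {A : Set X}, FunAdd X α A →
    FunAdd E α (Subtype.val ⁻¹' A)
  | _, _, .base A h => .base _ (by
      obtain ⟨f, hf, h, rfl⟩ := h
      exact ⟨fun x => f x, hf.comp continuous_subtype_val, fun x => h x, rfl⟩)
  | _, _, .union α hα β hβ s hs => by
      rw [preimage_iUnion]
      exact .union α hα β hβ _ (fun n => mul_restr E (hs n))
theorem mul_restr (E : Set X) : ∀ {α : Ordinal.{0}} {A : Set X}, FunMul X α A →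
    FunMul E α (Subtype.val ⁻¹' A)
  | _, _, .base A h => .base _ (by
      obtain ⟨f, hf, h, rfl⟩ := h
      exact ⟨fun x => f x, hf.comp continuous_subtype_val, fun x => h x, rfl⟩)
  | _, _, .inter α hα β hβ s hs => by
      rw [preimage_iInter]
      exact .inter α hα β hβ _ (fun n => add_restr E (hs n))
end

theorem add_inv {α : Ordinal.{0}} (hα : α ≠ 0) {A : Set X} (h : FunAdd X α A) :
    ∃ (β : ℕ → Ordinal.{0}) (s : ℕ → Set X), (∀ n, β n < α) ∧ (∀ n, FunMul X (β n) (s n)) ∧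
      A = ⋃ n, s n := by
  cases h with
  | base _ _ => exact absurd rfl hα
  | union _ _ β hβ s hs => exact ⟨β, s, hβ, hs, rfl⟩

theorem mul_to_add {α β : Ordinal.{0}} (h : β < α) {A : Set X} (hA : FunMul X β A) :
    FunAdd X α A := by
  have := FunAdd.union (X := X) α (ne_bot_of_gt h) (fun _ => β) (fun _ => h) (fun _ => A)
    (fun _ => hA)
  rwa [iUnion_const] at this

theorem add_to_mul {α β : Ordinal.{0}} (h : β < α) {A : Set X} (hA : FunAdd X β A) :
    FunMul X α A := by
  have := add_compl (mul_to_add h (add_compl hA))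
  rwa [compl_compl] at this

theorem add_iUnion {α : Ordinal.{0}} (hα : α ≠ 0) {A : ℕ → Set X}
    (h : ∀ n, FunAdd X α (A n)) : FunAdd X α (⋃ n, A n) := by
  choose β s hβ hs hA using fun n => add_inv hα (h n)
  have := FunAdd.union (X := X) α hα (fun n => β n.unpair.1 n.unpair.2) (fun _ => hβ _ _)
    (fun n => s n.unpair.1 n.unpair.2) (fun _ => hs _ _)
  convert this using 1
  ext x
  simp only [hA, mem_iUnion]
  constructor
  · rintro ⟨i, j, h⟩
    exact ⟨Nat.pair i j, by simpa using h⟩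
  · rintro ⟨i, h⟩
    exact ⟨_, _, h⟩

theorem add_mono {α β : Ordinal.{0}} (h : β ≤ α) {A : Set X} (hA : FunAdd X β A) :
    FunAdd X α A := by
  rcases h.eq_or_lt with rfl | h
  · exact hA
  have hα : α ≠ 0 := ne_bot_of_gt h
  cases hA with
  | union _ _ γ hγ s hs => exact .union α hα γ (fun n => (hγ n).trans h) s hs
  | base _ hA =>
    obtain ⟨f, hf, hI, rfl⟩ := hA
    have : f ⁻¹' Ioc 0 1 = ⋃ n : ℕ, {x | 1 / ((n : ℝ) + 1) ≤ f x} := by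
      ext x
      simp only [mem_preimage, mem_Ioc, mem_iUnion, mem_ofPred_eq]
      constructor
      · rintro ⟨h0, _⟩
        obtain ⟨n, hn⟩ := exists_nat_one_div_lt h0
        exact ⟨n, hn.le⟩
      · rintro ⟨n, hn⟩
        exact ⟨lt_of_lt_of_le (by positivity) hn, (hI x).2⟩
    rw [this]
    refine .union α hα (fun _ => 0) (fun _ => h) _ (fun n => .base _ ?_)
    have hp : (0 : ℝ) < 1 / ((n : ℝ) + 1) := by positivity
    have hp1 : 1 / ((n : ℝ) + 1) ≤ 1 := by
      rw [div_le_one (by positivity)]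
      linarith [(Nat.cast_nonneg n : (0 : ℝ) ≤ n)]
    refine ⟨fun x => max (1 / ((n : ℝ) + 1) - f x) 0, by fun_prop, fun x => ?_, ?_⟩
    · exact ⟨le_max_right _ _, max_le (by linarith [(hI x).1]) zero_le_one⟩
    · ext x
      simp only [mem_ofPred_eq, mem_preimage, mem_singleton_iff, max_eq_right_iff, sub_nonpos]

theorem mul_mono {α β : Ordinal.{0}} (h : β ≤ α) {A : Set X} (hA : FunMul X β A) :
    FunMul X α A := by
  have := add_compl (add_mono h (mul_compl hA))
  rwa [compl_compl] at this

theorem mul_iInter {α : Ordinal.{0}} (hα : α ≠ 0) {A : ℕ → Set X}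
    (h : ∀ n, FunMul X α (A n)) : FunMul X α (⋂ n, A n) := by
  have := add_compl (add_iUnion hα (fun n => mul_compl (h n)))
  simpa [compl_iUnion] using this

theorem mul_inter {α : Ordinal.{0}} {A B : Set X}
    (hA : FunMul X α A) (hB : FunMul X α B) : FunMul X α (A ∩ B) := by
  by_cases hα : α = 0
  · subst hα
    cases hA with
    | inter _ h => exact absurd rfl h
    | base _ hA =>
    cases hB with
    | inter _ h => exact absurd rfl h
    | base _ hB =>
    obtain ⟨f, hf, hfI, rfl⟩ := hA
    obtain ⟨g, hg, hgI, rfl⟩ := hB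
    refine .base _ ⟨fun x => max (f x) (g x), by fun_prop, fun x => ⟨le_max_of_le_left (hfI x).1,
      max_le (hfI x).2 (hgI x).2⟩, ?_⟩
    ext x
    have h1 := (hfI x).1
    have h2 := (hgI x).1
    simp only [mem_inter_iff, mem_preimage, mem_singleton_iff]
    constructor
    · rintro ⟨a, b⟩
      simp [a, b]
    · intro h
      have := le_max_left (f x) (g x)
      have := le_max_right (f x) (g x)
      constructor <;> linarith
  · have := mul_iInter (X := X) hα (A := fun n => if n = 0 then A else B)
      (fun n => by split_ifs <;> assumption)
    convert this using 1
    ext x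
    simp only [mem_inter_iff, mem_iInter]
    constructor
    · intro h n
      split_ifs
      exacts [h.1, h.2]
    · intro h
      exact ⟨by simpa using h 0, by simpa using h 1⟩

theorem add_union {α : Ordinal.{0}} {A B : Set X}
    (hA : FunAdd X α A) (hB : FunAdd X α B) : FunAdd X α (A ∪ B) := by
  have := mul_compl (mul_inter (add_compl hA) (add_compl hB))
  rwa [compl_inter, compl_compl, compl_compl] at this

theorem add_inter {α : Ordinal.{0}} (hα : α ≠ 0) {A B : Set X}
    (hA : FunAdd X α A) (hB : FunAdd X α B) : FunAdd X α (A ∩ B) := by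
  obtain ⟨β, s, hβ, hs, rfl⟩ := add_inv hα hA
  obtain ⟨γ, t, hγ, ht, rfl⟩ := add_inv hα hB
  rw [iUnion_inter]
  refine add_iUnion hα (fun n => ?_)
  rw [inter_iUnion]
  refine add_iUnion hα (fun m => ?_)
  exact mul_to_add (max_lt (hβ n) (hγ m))
    (mul_inter (mul_mono (le_max_left _ _) (hs n)) (mul_mono (le_max_right _ _) (ht m)))

theorem mul_union {α : Ordinal.{0}} (hα : α ≠ 0) {A B : Set X}
    (hA : FunMul X α A) (hB : FunMul X α B) : FunMul X α (A ∪ B) := by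
  have := add_compl (add_inter hα (mul_compl hA) (mul_compl hB))
  rwa [compl_inter, compl_compl, compl_compl] at this

theorem add_empty (α : Ordinal.{0}) : FunAdd X α ∅ :=
  add_mono (zero_le) (.base _ ⟨fun _ => 0, continuous_const, fun _ => by simp, by simp⟩)

theorem mul_empty' (α : Ordinal.{0}) : FunMul X α ∅ :=
  mul_mono (zero_le) (.base _ ⟨fun _ => 1, continuous_const, fun _ => by simp, by simp⟩)

/-- an additive set is a countable union of ambiguous sets -/
theorem add_amb {α : Ordinal.{0}} (hα : α ≠ 0) {A : Set X} (h : FunAdd X α A) :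
    ∃ s : ℕ → Set X, (∀ n, FunAmbiguous X α (s n)) ∧ A = ⋃ n, s n := by
  obtain ⟨β, s, hβ, hs, rfl⟩ := add_inv hα h
  exact ⟨s, fun n => ⟨mul_to_add (hβ n) (hs n), mul_mono (hβ n).le (hs n)⟩, rfl⟩

theorem amb_diff {α : Ordinal.{0}} (hα : α ≠ 0) {A B : Set X}
    (hA : FunAmbiguous X α A) (hB : FunAmbiguous X α B) : FunAmbiguous X α (A \ B) := by
  rw [sdiff_eq]
  exact ⟨add_inter hα hA.1 (mul_compl hB.2), mul_inter hA.2 (add_compl hB.1)⟩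

theorem step_fun {α : Ordinal.{0}} (hα : α ≠ 0) {W : ℕ → Set X}
    (h : ∀ n, FunAdd X α (W n)) (hc : ∀ x, ∃ n, x ∈ W n) (c : ℕ → ℝ) :
    ∃ g : X → ℝ, KClass α g ∧ ∀ x, ∃ n, x ∈ W n ∧ g x = c n := by
  classical
  choose s hs hW using fun n => add_amb hα (h n)
  let D : ℕ → Set X := fun n => s n.unpair.1 n.unpair.2
  have hD : ∀ n, FunAmbiguous X α (disjointed D n) := fun n =>
    disjointedRec (p := fun t => FunAmbiguous X α t) (fun {t} i ht => amb_diff hα ht (hs _ _)) (hs _ _)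
  have hcov : ∀ x, ∃ n, x ∈ disjointed D n := by
    intro x
    obtain ⟨n, hn⟩ := hc x
    rw [hW, mem_iUnion] at hn
    obtain ⟨m, hm⟩ := hn
    rw [← mem_iUnion, iUnion_disjointed, mem_iUnion]
    exact ⟨Nat.pair n m, by simpa [D] using hm⟩
  choose N hN using hcov
  have huniq : ∀ x n, x ∈ disjointed D n → N x = n := by
    intro x n hn
    by_contra hne
    exact Set.disjoint_left.1 (disjoint_disjointed D hne) (hN x) hn
  refine ⟨fun x => c (N x).unpair.1, ⟨fun h => absurd h hα, fun _ V _ => ?_⟩, fun x => ?_⟩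
  · have : (fun x => c (N x).unpair.1) ⁻¹' V =
        ⋃ n, (if c n.unpair.1 ∈ V then disjointed D n else ∅) := by
      ext x
      simp only [mem_preimage, mem_iUnion]
      constructor
      · intro hx
        exact ⟨N x, by rw [if_pos hx]; exact hN x⟩
      · rintro ⟨n, hn⟩
        split_ifs at hn with hV
        · rwa [huniq x n hn]
        · exact absurd hn (notMem_empty x)
    rw [this]
    refine add_iUnion hα (fun n => ?_)
    split_ifs
    · exact (hD n).1
    · exact add_empty α
  · refine ⟨(N x).unpair.1, ?_, rfl⟩
    rw [hW, mem_iUnion]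
    exact ⟨_, disjointed_subset D _ (hN x)⟩

theorem sep_mul {α : Ordinal.{0}} (hα : α ≠ 0) {A B : Set X}
    (hA : FunMul X α A) (hB : FunMul X α B) (hAB : ∀ x, x ∈ A → x ∉ B) : AlphaSeparated α A B := by
  obtain ⟨g, hg, h⟩ := step_fun hα (W := fun n => if n = 0 then Aᶜ else Bᶜ)
    (fun n => by split_ifs; exacts [mul_compl hA, mul_compl hB])
    (fun x => by
      by_cases hx : x ∈ A
      · exact ⟨1, by simpa using hAB x hx⟩
      · exact ⟨0, by simpa using hx⟩) (fun n => if n = 0 then 1 else 0)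
  refine ⟨g, hg, fun x hx => ?_, fun x hx => ?_⟩
  · obtain ⟨n, h1, h2⟩ := h x
    split_ifs at h1 h2
    · exact absurd hx h1
    · exact h2
  · obtain ⟨n, h1, h2⟩ := h x
    split_ifs at h1 h2
    · exact h2
    · exact absurd hx h1

theorem k_comp2 {α : Ordinal.{0}} (hα : α ≠ 0) {f g : X → ℝ} (hf : KClass α f) (hg : KClass α g)
    {φ : ℝ × ℝ → ℝ} (hφ : Continuous φ) : KClass α (fun x => φ (f x, g x)) := by
  refine ⟨fun h => absurd h hα, fun _ V hV => ?_⟩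
  have hO := hV.preimage hφ
  have hb := (TopologicalSpace.isBasis_countableBasis ℝ).prod
    (TopologicalSpace.isBasis_countableBasis ℝ)
  obtain ⟨S, hS, hSe⟩ := hb.open_eq_sUnion hO
  have hSc : S.Countable := (((TopologicalSpace.countable_countableBasis ℝ).image2
    (TopologicalSpace.countable_countableBasis ℝ) _)).mono hS
  have hpre : (fun x => φ (f x, g x)) ⁻¹' V = ⋃ T ∈ S, (fun x => (f x, g x)) ⁻¹' T := by
    rw [← preimage_iUnion₂, ← sUnion_eq_biUnion, ← hSe]; rfl
  rw [hpre]
  rcases S.eq_empty_or_nonempty with rfl | hne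
  · simpa using add_empty α
  obtain ⟨T, rfl⟩ := hSc.exists_eq_range hne
  rw [biUnion_range]
  refine add_iUnion hα (fun n => ?_)
  obtain ⟨a, ha, b, hb, hab⟩ := hS (mem_range_self n)
  rw [← hab]
  exact add_inter hα (hf.2 hα a (TopologicalSpace.isOpen_of_mem_countableBasis ha))
    (hg.2 hα b (TopologicalSpace.isOpen_of_mem_countableBasis hb))

theorem k_limit {α : Ordinal.{0}} (hα : α ≠ 0) {f : ℕ → X → ℝ} {g : X → ℝ}
    (hf : ∀ n, KClass α (f n)) (ε : ℕ → ℝ) (hε : Filter.Tendsto ε Filter.atTop (nhds 0))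
    (h : ∀ n x, dist (f n x) (g x) ≤ ε n) : KClass α g := by
  refine ⟨fun h => absurd h hα, fun _ V hV => ?_⟩
  have : g ⁻¹' V = ⋃ n, f n ⁻¹' (interior {y | Metric.closedBall y (ε n) ⊆ V}) := by
    ext x
    simp only [mem_preimage, mem_iUnion]
    constructor
    · intro hx
      obtain ⟨δ, hδ, hb⟩ := Metric.isOpen_iff.1 hV _ hx
      obtain ⟨n, hn⟩ := (hε.eventually (gt_mem_nhds (show (0 : ℝ) < δ / 3 by positivity))).exists
      refine ⟨n, mem_interior.2 ⟨Metric.ball (g x) (δ / 3), ?_, Metric.isOpen_ball, ?_⟩⟩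
      · intro y hy z hz
        apply hb
        rw [Metric.mem_ball] at *
        rw [Metric.mem_closedBall] at hz
        linarith [dist_triangle z y (g x)]
      · rw [Metric.mem_ball]
        exact (h n x).trans_lt hn
    · rintro ⟨n, hn⟩
      refine interior_subset hn ?_
      rw [Metric.mem_closedBall, dist_comm]
      exact h n x
  rw [this]
  exact add_iUnion hα (fun n => (hf n).2 hα _ isOpen_interior)

theorem approx {α : Ordinal.{0}} (hα : α ≠ 0) {E : Set X} (hE : AlphaEmbedded α E)
    (hS : ∀ A : Set X, FunMul X α A → E ∩ A = ∅ → AlphaSeparated α E A)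
    {f : E → ℝ} (hf : KClass α f) {ε : ℝ} (hε : 0 < ε) :
    ∃ g : X → ℝ, KClass α g ∧ ∀ x : E, dist (g x) (f x) < ε := by
  let c := TopologicalSpace.denseSeq ℝ
  choose B hB hBE using fun n => hE.1 _ (hf.2 hα (Metric.ball (c n) ε) Metric.isOpen_ball)
  have hmem : ∀ n (x : E), (x : X) ∈ B n ↔ f x ∈ Metric.ball (c n) ε := by
    intro n x
    have : (x : X) ∈ Subtype.val '' (f ⁻¹' Metric.ball (c n) ε) ↔ (x : X) ∈ B n ∩ E := by
      rw [hBE n]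
    simpa using this.symm
  obtain ⟨u, hu, huE, huA⟩ := hS (⋃ n, B n)ᶜ (add_compl (add_iUnion hα hB)) (by
    ext x
    simp only [mem_inter_iff, mem_compl_iff, mem_iUnion, mem_empty_iff_false, iff_false, not_and,
      not_not]
    intro hx
    obtain ⟨n, hn⟩ := (TopologicalSpace.denseRange_denseSeq ℝ).exists_dist_lt (f ⟨x, hx⟩) hε
    exact ⟨n, (hmem n ⟨x, hx⟩).2 hn⟩)
  obtain ⟨g, hg, h⟩ := step_fun hα (W := fun n => Nat.casesOn n (u ⁻¹' {0}ᶜ) B)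
    (fun n => by
      cases n with
      | zero => exact hu.2 hα _ isOpen_compl_singleton
      | succ n => exact hB n)
    (fun x => by
      by_cases hx : ∃ n, x ∈ B n
      · obtain ⟨n, hn⟩ := hx
        exact ⟨n + 1, hn⟩
      · refine ⟨0, ?_⟩
        have : u x = 1 := huA (by simpa using hx)
        simp [this]) (fun n => Nat.casesOn n 0 c)
  refine ⟨g, hg, fun x => ?_⟩
  obtain ⟨n, h1, h2⟩ := h x
  cases n with
  | zero => exact absurd (huE x.2) h1
  | succ n =>
    have := (hmem n x).1 h1
    rw [h2, dist_comm]
    exact this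

theorem extend {α : Ordinal.{0}} (hα : α ≠ 0) {E : Set X} (hE : AlphaEmbedded α E)
    (hS : ∀ A : Set X, FunMul X α A → E ∩ A = ∅ → AlphaSeparated α E A)
    {f : E → ℝ} (hf : KClass α f) : ∃ g : X → ℝ, KClass α g ∧ ∀ x : E, g x = f x := by
  choose h hh hhf using fun n : ℕ => approx hα hE hS hf (ε := 1 / 2 ^ n) (by positivity)
  let G : ℕ → X → ℝ := fun n => Nat.rec (h 0)
    (fun n g x => max (min (h (n + 1) x) (g x + 2 / 2 ^ n)) (g x - 2 / 2 ^ n)) n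
  have hG0 : G 0 = h 0 := rfl
  have hGs : ∀ n x, G (n + 1) x =
    max (min (h (n + 1) x) (G n x + 2 / 2 ^ n)) (G n x - 2 / 2 ^ n) := fun n x => rfl
  have hGK : ∀ n, KClass α (G n) := by
    intro n
    induction n with
    | zero => exact hh 0
    | succ n ih =>
      exact k_comp2 hα (hh (n + 1)) ih
        (φ := fun p => max (min p.1 (p.2 + 2 / 2 ^ n)) (p.2 - 2 / 2 ^ n)) (by fun_prop)
  have hGE : ∀ n (x : E), G n x = h n x := by
    intro n
    induction n with
    | zero => intro x; rfl
    | succ n ih =>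
      intro x
      rw [hGs, ih]
      have h1 := hhf n x
      have h2 := hhf (n + 1) x
      rw [Real.dist_eq, abs_lt] at h1 h2
      have h3 : (1 : ℝ) / 2 ^ (n + 1) ≤ 1 / 2 ^ n := by
        apply one_div_le_one_div_of_le (by positivity)
        exact pow_le_pow_right₀ (by norm_num) (Nat.le_succ n)
      have h4 : (2 : ℝ) / 2 ^ n = 1 / 2 ^ n + 1 / 2 ^ n := by ring
      rw [min_eq_left (by linarith), max_eq_left (by linarith)]
  have hd : ∀ x n, dist (G n x) (G (n + 1) x) ≤ 4 / 2 / 2 ^ n := by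
    intro x n
    have hp : (0 : ℝ) < 2 / 2 ^ n := by positivity
    have h4 : (4 : ℝ) / 2 / 2 ^ n = 2 / 2 ^ n := by norm_num
    rw [h4, hGs, Real.dist_eq, abs_sub_le_iff]
    constructor
    · linarith [le_max_right (min (h (n + 1) x) (G n x + 2 / 2 ^ n)) (G n x - 2 / 2 ^ n)]
    · have : max (min (h (n + 1) x) (G n x + 2 / 2 ^ n)) (G n x - 2 / 2 ^ n) ≤ G n x + 2 / 2 ^ n :=
        max_le (min_le_right _ _) (by linarith)
      linarith
  choose g hg using fun x => cauchySeq_tendsto_of_complete (cauchySeq_of_le_geometric_two (hd x))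
  have hlim : ∀ c : ℝ, Filter.Tendsto (fun n : ℕ => c / 2 ^ n) Filter.atTop (nhds 0) := fun c =>
    Filter.Tendsto.const_div_atTop (tendsto_pow_atTop_atTop_of_one_lt (by norm_num)) c
  refine ⟨g, k_limit hα hGK _ (hlim 4)
    (fun n x => dist_le_of_le_geometric_two_of_tendsto (hd x) (hg x) n), fun x => ?_⟩
  refine tendsto_nhds_unique (hg x) ?_
  rw [tendsto_iff_dist_tendsto_zero]
  refine squeeze_zero (fun _ => dist_nonneg) (fun n => ?_) (hlim 1)
  rw [hGE]
  exact (hhf n x).le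

theorem amb_ext {α : Ordinal.{0}} (hα : α ≠ 0) {E : Set X}
    (hK : ∀ f : E → ℝ, KClass α f → ∃ g : X → ℝ, KClass α g ∧ ∀ x : E, g x = f x)
    {A : Set E} (hA : FunAdd E α A) : ∃ B : Set X, FunAdd X α B ∧ Subtype.val '' A = B ∩ E := by
  classical
  obtain ⟨s, hs, rfl⟩ := add_amb hα hA
  have : ∀ n, ∃ B : Set X, FunAdd X α B ∧ ∀ x : E, (x : X) ∈ B ↔ x ∈ s n := by
    intro n
    obtain ⟨f, hf, h0, h1⟩ := sep_mul hα (hs n).2 (add_compl (hs n).1) (fun x h h' => h' h)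
    obtain ⟨g, hg, hgf⟩ := hK f hf
    refine ⟨g ⁻¹' {1}ᶜ, hg.2 hα _ isOpen_compl_singleton, fun x => ?_⟩
    simp only [mem_preimage, hgf, mem_compl_iff, mem_singleton_iff]
    constructor
    · intro h
      by_contra hx
      exact h (h1 hx)
    · intro h h'
      have : f x = 0 := h0 h
      rw [this] at h'
      exact zero_ne_one h'
  choose B hB hBs using this
  refine ⟨⋃ n, B n, add_iUnion hα hB, ?_⟩
  ext x
  simp only [mem_image, mem_iUnion, mem_inter_iff]
  constructor
  · rintro ⟨y, ⟨n, hn⟩, rfl⟩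
    exact ⟨⟨n, (hBs n y).2 hn⟩, y.2⟩
  · rintro ⟨⟨n, hn⟩, hx⟩
    exact ⟨⟨x, hx⟩, ⟨n, (hBs n ⟨x, hx⟩).1 hn⟩, rfl⟩

theorem sep_of_ext {α : Ordinal.{0}} (hα : α ≠ 0) {E : Set X}
    (hK : ∀ f : E → ℝ, KClass α f → ∃ g : X → ℝ, KClass α g ∧ ∀ x : E, g x = f x)
    {A : Set X} (hA : FunMul X α A) (hEA : E ∩ A = ∅) : AlphaSeparated α E A := by
  obtain ⟨C, hC, hAC⟩ := add_amb hα (mul_compl hA)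
  obtain ⟨f, hf, hfC⟩ := step_fun (X := E) hα (W := fun n => Subtype.val ⁻¹' (C n))
    (fun n => add_restr E (hC n).1) (fun x => by
      have : (x : X) ∈ Aᶜ := fun h => by
        have : (x : X) ∈ E ∩ A := ⟨x.2, h⟩
        rw [hEA] at this
        exact this
      rw [hAC, mem_iUnion] at this
      exact this) (fun n => n)
  obtain ⟨g, hg, hgf⟩ := hK f hf
  have hfin : ∀ k : ℕ, FunMul X α (⋃ n, ⋃ (_ : n < k), C n) := by
    intro k
    induction k with
    | zero => simpa using mul_empty' α
    | succ k ih =>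
      rw [biUnion_lt_succ]
      exact mul_union hα ih (hC k).2
  have hge : ∀ k : ℕ, FunMul X α {x | (k : ℝ) ≤ g x} := by
    intro k
    have := add_compl (hg.2 hα (Iio (k : ℝ)) isOpen_Iio)
    convert this using 1
    ext x
    simp
  obtain ⟨v, hv, h0, h1⟩ := sep_mul hα
    (mul_iInter hα fun k : ℕ => mul_union hα (hge k) (hfin k)) hA (fun x hx hxA => by
      obtain ⟨k, hk⟩ := exists_nat_gt (g x)
      rcases mem_iInter.1 hx k with h | h
      · exact absurd h (not_le.2 hk)
      · simp only [mem_iUnion] at h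
        obtain ⟨n, _, hn⟩ := h
        have : x ∈ Aᶜ := by rw [hAC]; exact mem_iUnion.2 ⟨n, hn⟩
        exact this hxA)
  refine ⟨v, hv, fun x hx => h0 ?_, h1⟩
  rw [mem_iInter]
  intro k
  obtain ⟨n, hn, hfn⟩ := hfC ⟨x, hx⟩
  rcases lt_or_ge n k with h | h
  · right
    simp only [mem_iUnion]
    exact ⟨n, h, hn⟩
  · left
    have : g x = n := (hgf ⟨x, hx⟩).trans hfn
    rw [mem_ofPred_eq, this]
    exact_mod_cast h

end helpers

/-- `E` is `K_α`-embedded in `X` iff `E` is `α`-embedded in `X` and `E` is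
`α`-separated from every disjoint set of the `α`'th functionally multiplicative class. -/
theorem stmt12 {X : Type u} [TopologicalSpace X] (α : Ordinal.{0}) (hα0 : 0 < α)
    (hα : α < omega1) (E : Set X) :
    (∀ f : ↥E → ℝ, KClass α f → ∃ g : X → ℝ, KClass α g ∧ ∀ x : ↥E, g ↑x = f x) ↔
    (AlphaEmbedded α E ∧
      ∀ A : Set X, FunMul X α A → E ∩ A = ∅ → AlphaSeparated α E A) := by
  have h0 : α ≠ 0 := hα0.ne'
  constructor
  · intro hK
    refine ⟨⟨fun A hA => amb_ext h0 hK hA, fun A hA => ?_⟩, fun A hA hEA => sep_of_ext h0 hK hA hEA⟩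
    obtain ⟨B, hB, hBA⟩ := amb_ext h0 hK (mul_compl hA)
    refine ⟨Bᶜ, add_compl hB, ?_⟩
    ext x
    have hx := Set.ext_iff.1 hBA x
    simp only [mem_image, mem_compl_iff, mem_inter_iff, Subtype.exists, exists_and_right,
      exists_eq_right] at hx ⊢
    constructor
    · rintro ⟨hE, hxA⟩
      refine ⟨fun hb => ?_, hE⟩
      obtain ⟨_, h⟩ := hx.2 ⟨hb, hE⟩
      exact h hxA
    · rintro ⟨hb, hE⟩
      refine ⟨hE, ?_⟩
      by_contra h
      exact hb (hx.1 ⟨hE, h⟩).1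
  · rintro ⟨hE, hS⟩ f hf
    exact extend h0 hE hS hf
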